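/- arXiv:2405.18173 — 2 statements merged into one kernel-verified Lean document; each statement's English description precedes it below -/
import Mathlib

section
/- Let G=(V,E,ω,μ) be an infinite, locally finite, connected weighted graph with D_μ<∞, let p>1, λ>0, and let ψ:V→[0,∞) be bounded with ψ≢0. Let u be the solution of u_t = Δu + u^p, u(·,0)=λψ on [0,T_λ), where T_λ is its life span, and let P(t,x,y) be the heat kernel of G. Then for every vertex x̄∈V and every 0 < t < T_λ, ( λ ∑_{y∈V} P(t,x̄,y)ψ(y)μ(y) )^{1-p} ≥ (p-1)t. -/
open Filter Topology Set
open scoped ENNReal Classical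

noncomputable section

/-- The graph Laplacian `Δu(x) = (1/μ(x)) ∑_y ω(x,y) (u(y) − u(x))`. -/
def graphLap {V : Type*} (ω : V → V → ℝ) (μ : V → ℝ) (u : V → ℝ) (x : V) : ℝ :=
  (1 / μ x) * ∑' y, ω x y * (u y - u x)

/-- `(V, ω, μ)` is a locally finite connected weighted graph: `ω` is symmetric and
nonnegative (with `ω x y > 0` exactly for neighbours), there are no loops, every
vertex has finitely many neighbours, `μ > 0`, and the graph is connected. -/
structure IsWeightedGraph {V : Type*} (ω : V → V → ℝ) (μ : V → ℝ) : Prop where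
  symm : ∀ x y, ω x y = ω y x
  nonneg : ∀ x y, 0 ≤ ω x y
  loopless : ∀ x, ω x x = 0
  locallyFinite : ∀ x, {y | 0 < ω x y}.Finite
  measurePos : ∀ x, 0 < μ x
  connected : ∀ x y, Relation.ReflTransGen (fun a b => 0 < ω a b) x y

/-- `D_μ = sup_x m(x)/μ(x) < ∞`, where `m(x) = ∑_{y ∼ x} ω(x,y)`. -/
def DmuFinite {V : Type*} (ω : V → V → ℝ) (μ : V → ℝ) : Prop :=
  ∃ C : ℝ, ∀ x, (∑' y, ω x y) ≤ C * μ x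

/-- A solution of `u_t = L u + u^p` on `V × [0,T)` with initial datum `ψ0`:
a nonnegative function, continuous in `t` on `[0,T)` for each fixed `x`,
bounded on `V × [0,T']` for every `T' < T`, differentiable in `t` on `(0,T)`
and satisfying the equation pointwise there. -/
structure IsHeatSol {V : Type*} (L : (V → ℝ) → V → ℝ) (p : ℝ)
    (ψ0 : V → ℝ) (T : ℝ) (u : V → ℝ → ℝ) : Prop where
  nonneg : ∀ x, ∀ t ∈ Ico (0:ℝ) T, 0 ≤ u x t
  cont : ∀ x, ContinuousOn (u x) (Ico (0:ℝ) T)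
  bounded : ∀ T' ∈ Ioo (0:ℝ) T, ∃ C : ℝ, ∀ x, ∀ t ∈ Icc (0:ℝ) T', |u x t| ≤ C
  eqn : ∀ x, ∀ t ∈ Ioo (0:ℝ) T,
    HasDerivAt (u x) (L (fun y => u y t) x + u x t ^ p) t
  init : ∀ x, u x 0 = ψ0 x

/-- The life span `T_λ`: the supremum (in `ℝ≥0∞`) of all `T > 0` such that the
problem has a solution on `[0,T)`. -/
def lifeSpan {V : Type*} (L : (V → ℝ) → V → ℝ) (p : ℝ) (ψ0 : V → ℝ) : ℝ≥0∞ :=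
  ⨆ (T : ℝ) (_ : 0 < T ∧ ∃ u, IsHeatSol L p ψ0 T u), ENNReal.ofReal T

/-- The heat kernel `P(t,x,y) = (e^{tΔ} δ_y^μ)(x)`, defined via the exponential
series, where `δ_y^μ(z) = 1/μ(y)` if `z = y` and `0` otherwise. -/
def heatKernel {V : Type*} (ω : V → V → ℝ) (μ : V → ℝ) (t : ℝ) (x y : V) : ℝ :=
  ∑' n : ℕ, t ^ n / (n.factorial : ℝ) *
    (graphLap ω μ)^[n] (fun z => if z = y then 1 / μ y else 0) x

open BoundedContinuousFunction NormedSpace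

section Exponential

variable {E : Type*} [NormedAddCommGroup E] [NormedSpace ℝ E]

/-- The semigroup `e^{τL}` generated by a bounded operator `L`. -/
def opSemigroup (L : E →L[ℝ] E) (τ : ℝ) : E →L[ℝ] E := exp (τ • L)

variable [CompleteSpace E]

lemma hasSum_apply_opSemigroup_apply (A : E →L[ℝ] E) (τ : ℝ) (f : E) (φ : E →L[ℝ] ℝ) :
    HasSum (fun n : ℕ => τ ^ n / (n.factorial : ℝ) * φ ((A ^ n) f)) (φ (opSemigroup A τ f)) := by
  have h := (exp_series_hasSum_exp' (𝕂 := ℝ) (τ • A)).mapL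
    (φ.comp (ContinuousLinearMap.apply ℝ E f))
  refine h.congr_fun fun n => ?_
  rw [smul_pow, smul_smul, map_smul, smul_eq_mul, div_eq_inv_mul]
  rfl

lemma opSemigroup_eq_exp_smul_opSemigroup_add (L : E →L[ℝ] E) (C τ : ℝ) :
    opSemigroup L τ = Real.exp (-(τ * C)) • opSemigroup (L + C • (1 : E →L[ℝ] E)) τ := by
  let : NormedAlgebra ℚ (E →L[ℝ] E) := .restrictScalars ℚ ℝ _
  have h1 : τ • L = (-(τ * C)) • (1 : E →L[ℝ] E) + τ • (L + C • (1 : E →L[ℝ] E)) := by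
    module
  have h2 : exp ((-(τ * C)) • (1 : E →L[ℝ] E)) = Real.exp (-(τ * C)) • (1 : E →L[ℝ] E) := by
    rw [← Algebra.algebraMap_eq_smul_one, ← Algebra.algebraMap_eq_smul_one, Real.exp_eq_exp_ℝ]
    exact (algebraMap_exp_comm _).symm
  rw [opSemigroup, opSemigroup, h1, exp_add_of_commute ((Commute.one_left _).smul_left _), h2,
    smul_mul_assoc, one_mul]

lemma hasDerivAt_opSemigroup_sub_apply (L : E →L[ℝ] E) (t : ℝ) {U : ℝ → E} {Q : E} {s : ℝ}
    (hU : HasDerivAt U (L (U s) + Q) s) :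
    HasDerivAt (fun r => opSemigroup L (t - r) (U r)) (opSemigroup L (t - s) Q) s := by
  have h := ((hasDerivAt_exp_smul_const (𝕂 := ℝ) L (t - s)).comp_const_sub t s).clm_apply hU
  refine h.congr_deriv ?_
  rw [map_add]
  change -(exp ((t - s) • L) (L (U s))) + _ = _
  rw [neg_add_cancel_left]
  rfl

lemma continuousOn_opSemigroup_sub_apply (L : E →L[ℝ] E) (t : ℝ) {U : ℝ → E} {S : Set ℝ}
    (hU : ContinuousOn U S) : ContinuousOn (fun r => opSemigroup L (t - r) (U r)) S := by
  have h : Continuous fun r : ℝ => exp ((t - r) • L) :=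
    continuous_iff_continuousAt.2 fun s =>
      ((hasDerivAt_exp_smul_const (𝕂 := ℝ) L (t - s)).comp_const_sub t s).continuousAt
  exact h.continuousOn.clm_apply hU

end Exponential

section Operators

variable {V : Type*} [TopologicalSpace V]

lemma hasSum_opSemigroup_apply (A : (V →ᵇ ℝ) →L[ℝ] (V →ᵇ ℝ)) (τ : ℝ) (f : V →ᵇ ℝ) (x : V) :
    HasSum (fun n : ℕ => τ ^ n / (n.factorial : ℝ) * (A ^ n) f x) (opSemigroup A τ f x) :=
  hasSum_apply_opSemigroup_apply A τ f (BoundedContinuousFunction.evalCLM ℝ x)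

lemma pow_apply_nonneg {A : (V →ᵇ ℝ) →L[ℝ] (V →ᵇ ℝ)}
    (hA : ∀ f : V →ᵇ ℝ, (∀ x, 0 ≤ f x) → ∀ x, 0 ≤ A f x)
    {f : V →ᵇ ℝ} (hf : ∀ x, 0 ≤ f x) (n : ℕ) (x : V) : 0 ≤ (A ^ n) f x := by
  induction n generalizing x with
  | zero => simpa using hf x
  | succ n ih =>
    rw [pow_succ']
    exact hA _ ih x

lemma opSemigroup_apply_nonneg {A : (V →ᵇ ℝ) →L[ℝ] (V →ᵇ ℝ)}
    (hA : ∀ f : V →ᵇ ℝ, (∀ x, 0 ≤ f x) → ∀ x, 0 ≤ A f x)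
    {τ : ℝ} (hτ : 0 ≤ τ) {f : V →ᵇ ℝ} (hf : ∀ x, 0 ≤ f x) (x : V) :
    0 ≤ opSemigroup A τ f x :=
  (hasSum_opSemigroup_apply A τ f x).nonneg fun n =>
    mul_nonneg (by positivity) (pow_apply_nonneg hA hf n x)

lemma opSemigroup_apply_pos {A : (V →ᵇ ℝ) →L[ℝ] (V →ᵇ ℝ)}
    (hA : ∀ f : V →ᵇ ℝ, (∀ x, 0 ≤ f x) → ∀ x, 0 ≤ A f x)
    {τ : ℝ} (hτ : 0 < τ) {f : V →ᵇ ℝ} (hf : ∀ x, 0 ≤ f x) {x : V}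
    (hx : ∃ n : ℕ, 0 < (A ^ n) f x) : 0 < opSemigroup A τ f x := by
  obtain ⟨n, hn⟩ := hx
  exact lt_of_lt_of_le (mul_pos (by positivity) hn)
    (le_hasSum (hasSum_opSemigroup_apply A τ f x) n fun m _ =>
      mul_nonneg (by positivity) (pow_apply_nonneg hA hf m x))

lemma opSemigroup_apply_const {L : (V →ᵇ ℝ) →L[ℝ] (V →ᵇ ℝ)}
    (hL : ∀ a : ℝ, L (BoundedContinuousFunction.const V a) = 0) (τ a : ℝ) (x : V) :
    opSemigroup L τ (BoundedContinuousFunction.const V a) x = a := by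
  refine (hasSum_opSemigroup_apply L τ _ x).unique ?_
  convert hasSum_single (f := fun n : ℕ => τ ^ n / (n.factorial : ℝ) *
    (L ^ n) (BoundedContinuousFunction.const V a) x) 0 ?_ using 1
  · simp
  · rintro (_ | n) hn
    · exact absurd rfl hn
    · simp [pow_succ, hL]

lemma rpow_tangent_le {p : ℝ} (hp : 1 < p) {a b : ℝ} (ha : 0 < a) (hb : 0 ≤ b) :
    a ^ p + p * a ^ (p - 1) * (b - a) ≤ b ^ p := by
  have h := one_add_mul_self_le_rpow_one_add (s := b / a - 1) (by linarith [div_nonneg hb ha.le])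
    hp.le
  rw [add_sub_cancel, Real.div_rpow hb ha.le, le_div_iff₀ (by positivity)] at h
  refine le_trans (le_of_eq ?_) h
  rw [Real.rpow_sub ha, Real.rpow_one]
  field_simp

/-- Jensen's inequality for a positive operator fixing the constants. -/
lemma rpow_le_of_positive {E : (V →ᵇ ℝ) →L[ℝ] (V →ᵇ ℝ)}
    (hE : ∀ f : V →ᵇ ℝ, (∀ x, 0 ≤ f x) → ∀ x, 0 ≤ E f x)
    (hE1 : ∀ (a : ℝ) (x : V), E (BoundedContinuousFunction.const V a) x = a)
    {p : ℝ} (hp : 1 < p) {f g : V →ᵇ ℝ} (hf : ∀ x, 0 ≤ f x) (hg : ∀ x, g x = f x ^ p) (x : V) :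
    (E f x) ^ p ≤ E g x := by
  rcases (hE f hf x).eq_or_lt with h0 | hpos
  · rw [← h0, Real.zero_rpow (by linarith)]
    exact hE g (fun y => by rw [hg]; exact Real.rpow_nonneg (hf y) p) x
  · set a := E f x with ha
    have h := hE (g - (BoundedContinuousFunction.const V (a ^ p) +
      (p * a ^ (p - 1)) • (f - BoundedContinuousFunction.const V a))) (fun y => by
        have := rpow_tangent_le hp hpos (hf y)
        simp only [coe_sub, coe_add, coe_smul, Pi.sub_apply, Pi.add_apply, const_apply, hg,
          smul_eq_mul]
        linarith) x
    simp only [map_sub, map_add, map_smul, coe_sub, coe_add, coe_smul, Pi.sub_apply,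
      Pi.add_apply, hE1, smul_eq_mul, ← ha] at h
    linarith

end Operators

lemma mul_le_rpow_of_rpow_le_deriv {p : ℝ} (hp : 1 < p) {t : ℝ} (ht : 0 < t) {v v' : ℝ → ℝ}
    (hv : ContinuousOn v (Icc 0 t)) (hd : ∀ s ∈ Ioo 0 t, HasDerivAt v (v' s) s)
    (hnn : ∀ s ∈ Ioo 0 t, 0 ≤ v s)
    (hle : ∀ s ∈ Ioo 0 t, v s ^ p ≤ v' s) (h0 : 0 < v 0) :
    (p - 1) * t ≤ v 0 ^ (1 - p) := by
  have hmem0 : (0 : ℝ) ∈ Icc 0 t := ⟨le_rfl, ht.le⟩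
  have hmemt : t ∈ Icc 0 t := ⟨ht.le, le_rfl⟩
  have hmono : MonotoneOn v (Icc 0 t) := by
    refine monotoneOn_of_hasDerivWithinAt_nonneg (f' := v') (convex_Icc _ _) hv ?_ ?_
    · intro s hs
      rw [interior_Icc] at hs
      exact (hd s hs).hasDerivWithinAt
    · intro s hs
      rw [interior_Icc] at hs
      exact (Real.rpow_nonneg (hnn s hs) p).trans (hle s hs)
  have hpos : ∀ s ∈ Icc 0 t, 0 < v s := fun s hs => h0.trans_le (hmono hmem0 hs hs.1)
  have hanti : AntitoneOn (fun s => v s ^ (1 - p) + (p - 1) * s) (Icc 0 t) := by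
    refine antitoneOn_of_hasDerivWithinAt_nonpos
      (f' := fun s => v' s * (1 - p) * v s ^ (1 - p - 1) + (p - 1) * 1) (convex_Icc _ _) ?_ ?_ ?_
    · exact (hv.rpow_const fun s hs => Or.inl (hpos s hs).ne').add (by fun_prop)
    · intro s hs
      rw [interior_Icc] at hs
      exact (((hd s hs).rpow_const (Or.inl (hpos s (Ioo_subset_Icc_self hs)).ne')).add
        ((hasDerivAt_id s).const_mul (p - 1))).hasDerivWithinAt
    · intro s hs
      rw [interior_Icc] at hs
      have hs0 := hpos s (Ioo_subset_Icc_self hs)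
      have h1 : v s ^ p * v s ^ (1 - p - 1) = 1 := by
        rw [← Real.rpow_add hs0]; simp
      have h2 : 1 ≤ v' s * v s ^ (1 - p - 1) := by
        refine h1.symm.trans_le ?_
        exact mul_le_mul_of_nonneg_right (hle s hs) (Real.rpow_nonneg hs0.le (1 - p - 1))
      nlinarith
  have h := hanti hmem0 hmemt ht.le
  have := Real.rpow_nonneg (hpos t hmemt).le (1 - p)
  simp only [mul_zero, add_zero] at h
  linarith

section Graph

variable {V : Type*} {ω : V → V → ℝ} {μ : V → ℝ}

namespace IsWeightedGraph

lemma eq_zero_of_notMem (hG : IsWeightedGraph ω μ) {x y : V}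
    (hy : y ∉ (hG.locallyFinite x).toFinset) : ω x y = 0 := by
  simp only [Finite.mem_toFinset, mem_ofPred_eq, not_lt] at hy
  exact le_antisymm hy (hG.nonneg x y)

lemma summable_mul (hG : IsWeightedGraph ω μ) (x : V) (g : V → ℝ) :
    Summable fun y => ω x y * g y :=
  summable_of_ne_finset_zero (s := (hG.locallyFinite x).toFinset) fun y hy => by
    rw [hG.eq_zero_of_notMem hy, zero_mul]

lemma summable (hG : IsWeightedGraph ω μ) (x : V) : Summable (ω x) := by
  simpa using hG.summable_mul x 1

lemma graphLap_eq (hG : IsWeightedGraph ω μ) (u : V → ℝ) (x : V) :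
    graphLap ω μ u x = (1 / μ x) * (∑' y, ω x y * u y - (∑' y, ω x y) * u x) := by
  rw [graphLap, ← tsum_mul_right, ← (hG.summable_mul x u).tsum_sub ((hG.summable x).mul_right _)]
  simp only [mul_sub]

lemma graphLap_eq_linearCombination (hG : IsWeightedGraph ω μ) (x : V) :
    ∃ c : V →₀ ℝ, ∀ g : V → ℝ, graphLap ω μ g x = Finsupp.linearCombination ℝ g c := by
  refine ⟨∑ y ∈ (hG.locallyFinite x).toFinset,
    (Finsupp.single y (1 / μ x * ω x y) - Finsupp.single x (1 / μ x * ω x y)), fun g => ?_⟩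
  rw [graphLap, tsum_eq_sum (s := (hG.locallyFinite x).toFinset)
    fun y hy => by rw [hG.eq_zero_of_notMem hy, zero_mul], map_sum,
    Finset.mul_sum]
  refine Finset.sum_congr rfl fun y _ => ?_
  simp only [map_sub, Finsupp.linearCombination_single, smul_eq_mul]
  ring

lemma iterate_graphLap_eq_linearCombination (hG : IsWeightedGraph ω μ) (n : ℕ) (x : V) :
    ∃ c : V →₀ ℝ, ∀ g : V → ℝ,
      (graphLap ω μ)^[n] g x = Finsupp.linearCombination ℝ g c := by
  induction n generalizing x with
  | zero => exact ⟨Finsupp.single x 1, fun g => by simp⟩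
  | succ n ih =>
    choose c hc using ih
    obtain ⟨d, hd⟩ := hG.graphLap_eq_linearCombination x
    refine ⟨Finsupp.linearCombination ℝ c d, fun g => ?_⟩
    rw [Function.iterate_succ_apply', hd, Finsupp.linearCombination_linearCombination]
    congr 2
    exact funext fun y => hc y g

lemma abs_graphLap_le (hG : IsWeightedGraph ω μ) {C : ℝ} (hC : ∀ x, (∑' y, ω x y) ≤ C * μ x)
    {u : V → ℝ} {B : ℝ} (hu : ∀ x, |u x| ≤ B) (x : V) : |graphLap ω μ u x| ≤ 2 * C * B := by
  have hμ := hG.measurePos x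
  have hB : 0 ≤ B := (abs_nonneg _).trans (hu x)
  have h1 : |∑' y, ω x y * (u y - u x)| ≤ (∑' y, ω x y) * (2 * B) := by
    rw [← Real.norm_eq_abs]
    refine tsum_of_norm_bounded ((hG.summable x).hasSum.mul_right (2 * B)) fun y => ?_
    rw [Real.norm_eq_abs, abs_mul, abs_of_nonneg (hG.nonneg x y)]
    refine mul_le_mul_of_nonneg_left ((norm_sub_le (u y) (u x)).trans ?_) (hG.nonneg x y)
    linarith [hu x, hu y, Real.norm_eq_abs (u x), Real.norm_eq_abs (u y)]
  rw [graphLap, abs_mul, abs_of_pos (by positivity)]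
  calc 1 / μ x * |∑' y, ω x y * (u y - u x)| ≤ 1 / μ x * (C * μ x * (2 * B)) := by
        gcongr
        exact h1.trans (by gcongr; exact hC x)
    _ = 2 * C * B := by field_simp

lemma abs_iterate_graphLap_le (hG : IsWeightedGraph ω μ) {C : ℝ}
    (hC : ∀ x, (∑' y, ω x y) ≤ C * μ x) {u : V → ℝ} {B : ℝ} (hu : ∀ x, |u x| ≤ B) (n : ℕ)
    (x : V) : |(graphLap ω μ)^[n] u x| ≤ (2 * C) ^ n * B := by
  induction n generalizing x with
  | zero => simpa using hu x
  | succ n ih =>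
    rw [Function.iterate_succ_apply', pow_succ', mul_assoc]
    exact hG.abs_graphLap_le hC ih x

lemma bound_nonneg (hG : IsWeightedGraph ω μ) {C : ℝ} (hC : ∀ x, (∑' y, ω x y) ≤ C * μ x)
    [Nonempty V] : 0 ≤ C := by
  obtain ⟨x⟩ := ‹Nonempty V›
  exact nonneg_of_mul_nonneg_left ((tsum_nonneg (hG.nonneg x)).trans (hC x)) (hG.measurePos x)

variable [TopologicalSpace V] [DiscreteTopology V] [Nonempty V]

/-- The graph Laplacian as a bounded operator on bounded functions. -/
def lapCLM (hG : IsWeightedGraph ω μ) {C : ℝ} (hC : ∀ x, (∑' y, ω x y) ≤ C * μ x) :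
    (V →ᵇ ℝ) →L[ℝ] (V →ᵇ ℝ) :=
  LinearMap.mkContinuous
    { toFun := fun f => ofNormedAddCommGroupDiscrete (graphLap ω μ f) (2 * C * ‖f‖)
        (hG.abs_graphLap_le hC f.norm_coe_le_norm)
      map_add' := fun f g => by
        ext x
        obtain ⟨c, hc⟩ := hG.graphLap_eq_linearCombination x
        simp [hc, Finsupp.linearCombination_apply, mul_add, Finsupp.sum_add]
      map_smul' := fun a f => by
        ext x
        obtain ⟨c, hc⟩ := hG.graphLap_eq_linearCombination x
        simp [hc, Finsupp.linearCombination_apply, Finsupp.mul_sum, mul_left_comm] }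
    (2 * C) fun f => norm_le_of_nonempty.2 (hG.abs_graphLap_le hC f.norm_coe_le_norm)

lemma lapCLM_apply (hG : IsWeightedGraph ω μ) {C : ℝ} (hC : ∀ x, (∑' y, ω x y) ≤ C * μ x)
    (f : V →ᵇ ℝ) (x : V) : hG.lapCLM hC f x = graphLap ω μ f x := rfl

lemma lapCLM_pow_apply (hG : IsWeightedGraph ω μ) {C : ℝ} (hC : ∀ x, (∑' y, ω x y) ≤ C * μ x)
    (n : ℕ) (f : V →ᵇ ℝ) (x : V) :
    (hG.lapCLM hC ^ n) f x = (graphLap ω μ)^[n] f x := by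
  induction n generalizing x with
  | zero => rfl
  | succ n ih =>
    rw [pow_succ', Function.iterate_succ_apply']
    exact congrArg (graphLap ω μ · x) (funext ih)

lemma lapCLM_const (hG : IsWeightedGraph ω μ) {C : ℝ} (hC : ∀ x, (∑' y, ω x y) ≤ C * μ x)
    (a : ℝ) : hG.lapCLM hC (BoundedContinuousFunction.const V a) = 0 := by
  ext x
  simp [lapCLM_apply, graphLap]

lemma mul_le_lapCLM_add_apply (hG : IsWeightedGraph ω μ) {C : ℝ}
    (hC : ∀ x, (∑' y, ω x y) ≤ C * μ x) {f : V →ᵇ ℝ} (hf : ∀ x, 0 ≤ f x) (x y : V) :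
    1 / μ x * (ω x y * f y) ≤ (hG.lapCLM hC + C • (1 : (V →ᵇ ℝ) →L[ℝ] (V →ᵇ ℝ))) f x := by
  have hμ := hG.measurePos x
  have h1 : ω x y * f y ≤ ∑' z, ω x z * f z :=
    (hG.summable_mul x f).le_tsum y fun z _ => mul_nonneg (hG.nonneg x z) (hf z)
  have h2 := mul_le_mul_of_nonneg_right (hC x) (hf x)
  calc 1 / μ x * (ω x y * f y)
      ≤ 1 / μ x * (∑' z, ω x z * f z + (C * μ x * f x - (∑' z, ω x z) * f x)) := by
        gcongr
        linarith
    _ = graphLap ω μ f x + C * f x := by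
        rw [hG.graphLap_eq]
        field_simp
        ring

lemma lapCLM_add_apply_nonneg (hG : IsWeightedGraph ω μ) {C : ℝ}
    (hC : ∀ x, (∑' y, ω x y) ≤ C * μ x) (f : V →ᵇ ℝ) (hf : ∀ x, 0 ≤ f x) (x : V) :
    0 ≤ (hG.lapCLM hC + C • (1 : (V →ᵇ ℝ) →L[ℝ] (V →ᵇ ℝ))) f x := by
  refine le_trans ?_ (hG.mul_le_lapCLM_add_apply hC hf x x)
  simp [hG.loopless]

lemma opSemigroup_lapCLM_apply_nonneg (hG : IsWeightedGraph ω μ) {C : ℝ}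
    (hC : ∀ x, (∑' y, ω x y) ≤ C * μ x) {τ : ℝ} (hτ : 0 ≤ τ) (f : V →ᵇ ℝ)
    (hf : ∀ x, 0 ≤ f x) (x : V) : 0 ≤ opSemigroup (hG.lapCLM hC) τ f x := by
  rw [opSemigroup_eq_exp_smul_opSemigroup_add _ C]
  exact mul_nonneg (Real.exp_pos _).le
    (opSemigroup_apply_nonneg (hG.lapCLM_add_apply_nonneg hC) hτ hf x)

lemma opSemigroup_lapCLM_apply_pos (hG : IsWeightedGraph ω μ) {C : ℝ}
    (hC : ∀ x, (∑' y, ω x y) ≤ C * μ x) {τ : ℝ} (hτ : 0 < τ) {f : V →ᵇ ℝ}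
    (hf : ∀ x, 0 ≤ f x) {z : V} (hz : f z ≠ 0) (x : V) :
    0 < opSemigroup (hG.lapCLM hC) τ f x := by
  rw [opSemigroup_eq_exp_smul_opSemigroup_add _ C]
  refine mul_pos (Real.exp_pos _)
    (opSemigroup_apply_pos (hG.lapCLM_add_apply_nonneg hC) hτ hf ?_)
  induction hG.connected z x with
  | refl => exact ⟨0, (hf z).lt_of_ne' hz⟩
  | @tail a b _ hab ih =>
    obtain ⟨n, hn⟩ := ih
    refine ⟨n + 1, ?_⟩
    rw [pow_succ']
    refine lt_of_lt_of_le ?_ (hG.mul_le_lapCLM_add_apply hC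
      (fun y => pow_apply_nonneg (hG.lapCLM_add_apply_nonneg hC) hf n y) b a)
    rw [hG.symm b a]
    exact mul_pos (one_div_pos.2 (hG.measurePos b)) (mul_pos hab hn)

lemma tsum_heatKernel_mul (hG : IsWeightedGraph ω μ) {C : ℝ}
    (hC : ∀ x, (∑' y, ω x y) ≤ C * μ x) (t : ℝ) (f : V →ᵇ ℝ) (x : V) :
    ∑' y, heatKernel ω μ t x y * f y * μ y = opSemigroup (hG.lapCLM hC) t f x := by
  choose c hc using fun n => hG.iterate_graphLap_eq_linearCombination n x
  have hsum : ∀ n, ∑ y ∈ (c n).support, |c n y| ≤ (2 * C) ^ n := by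
    intro n
    have h := hG.abs_iterate_graphLap_le hC (u := fun y => SignType.sign (c n y)) (B := 1)
      (fun y => by rcases lt_trichotomy (c n y) 0 with h | h | h <;> simp [h]) n x
    rw [hc, mul_one, Finsupp.linearCombination_apply, Finsupp.sum] at h
    refine le_trans (le_of_eq ?_) ((le_abs_self _).trans h)
    exact Finset.sum_congr rfl fun y _ => by simp [← self_mul_sign]
  have hkernel : ∀ y, heatKernel ω μ t x y * f y * μ y =
      ∑' n : ℕ, t ^ n / (n.factorial : ℝ) * (c n y * f y) := by
    intro y
    have hμ := hG.measurePos y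
    rw [heatKernel, ← tsum_mul_right, ← tsum_mul_right]
    refine tsum_congr fun n => ?_
    have : Finsupp.linearCombination ℝ (fun z => if z = y then 1 / μ y else 0) (c n) =
        c n y * (1 / μ y) := by
      rw [Finsupp.linearCombination_apply, Finsupp.sum_eq_single y] <;> simp +contextual
    rw [hc, this]
    field_simp
  have hsupp : ∀ n, ∀ y ∉ (c n).support, t ^ n / (n.factorial : ℝ) * (c n y * f y) = 0 :=
    fun n y hy => by simp [Finsupp.notMem_support_iff.1 hy]
  have hsummable : Summable (Function.uncurry fun (n : ℕ) (y : V) =>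
      t ^ n / (n.factorial : ℝ) * (c n y * f y)) := by
    refine Summable.of_norm ((summable_prod_of_nonneg fun _ => norm_nonneg _).2 ⟨fun n => ?_, ?_⟩)
    · exact summable_of_ne_finset_zero (s := (c n).support) fun y hy =>
        norm_eq_zero.2 (hsupp n y hy)
    · refine Summable.of_nonneg_of_le (fun n => tsum_nonneg fun y => norm_nonneg _) (fun n => ?_)
        ((Real.summable_pow_div_factorial (|t| * (2 * C))).mul_right ‖f‖)
      change ∑' y, ‖t ^ n / (n.factorial : ℝ) * (c n y * f y)‖ ≤ _
      rw [tsum_eq_sum (s := (c n).support) fun y hy => norm_eq_zero.2 (hsupp n y hy)]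
      calc ∑ y ∈ (c n).support, ‖t ^ n / (n.factorial : ℝ) * (c n y * f y)‖
          ≤ ∑ y ∈ (c n).support, |t| ^ n / (n.factorial : ℝ) * ‖f‖ * |c n y| := by
            refine Finset.sum_le_sum fun y _ => ?_
            rw [norm_mul, norm_mul, norm_div, norm_pow, Real.norm_natCast, Real.norm_eq_abs,
              Real.norm_eq_abs (c n y), mul_comm |c n y|, ← mul_assoc]
            gcongr
            exact f.norm_coe_le_norm y
        _ ≤ |t| ^ n / (n.factorial : ℝ) * ‖f‖ * (2 * C) ^ n := by
            rw [← Finset.mul_sum]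
            gcongr
            exact hsum n
        _ = (|t| * (2 * C)) ^ n / (n.factorial : ℝ) * ‖f‖ := by
            rw [mul_pow]
            ring
  rw [tsum_congr hkernel, hsummable.tsum_comm, ← (hasSum_opSemigroup_apply _ t f x).tsum_eq]
  refine tsum_congr fun n => ?_
  rw [tsum_eq_sum (hsupp n), ← Finset.mul_sum, lapCLM_pow_apply, hc,
    Finsupp.linearCombination_apply]
  rfl

end IsWeightedGraph

end Graph

section Regularity

lemma abs_sub_le_of_abs_deriv_le {f f' : ℝ → ℝ} {a b M : ℝ} (hf : ContinuousOn f (Icc a b))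
    (hd : ∀ s ∈ Ioo a b, HasDerivAt f (f' s) s) (hM : ∀ s ∈ Ioo a b, |f' s| ≤ M)
    {r s : ℝ} (hr : r ∈ Icc a b) (hs : s ∈ Icc a b) : |f r - f s| ≤ M * |r - s| := by
  wlog h : s < r generalizing r s
  · rcases (not_lt.1 h).eq_or_lt with rfl | h
    · simp
    · rw [abs_sub_comm, abs_sub_comm r]
      exact this hs hr h
  obtain ⟨c, hc, hcs⟩ := exists_hasDerivAt_eq_slope f f' h
    (hf.mono (Icc_subset_Icc hs.1 hr.2)) fun c hc => hd c ⟨hs.1.trans_lt hc.1, hc.2.trans_le hr.2⟩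
  have h2 : f r - f s = f' c * (r - s) := by
    rw [hcs, div_mul_cancel₀ _ (sub_pos.2 h).ne']
  rw [h2, abs_mul]
  exact mul_le_mul_of_nonneg_right (hM c ⟨hs.1.trans_lt hc.1, hc.2.trans_le hr.2⟩) (abs_nonneg _)

lemma abs_rpow_sub_rpow_le {p : ℝ} (hp : 1 < p) {R a b : ℝ} (ha : a ∈ Icc 0 R)
    (hb : b ∈ Icc 0 R) : |a ^ p - b ^ p| ≤ p * R ^ (p - 1) * |a - b| := by
  refine abs_sub_le_of_abs_deriv_le (f' := fun s => p * s ^ (p - 1))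
    (continuousOn_id.rpow_const fun _ _ => Or.inr (by linarith))
    (fun s _ => Real.hasDerivAt_rpow_const (Or.inr hp.le)) (fun s hs => ?_) ha hb
  rw [abs_of_nonneg (mul_nonneg (by linarith) (Real.rpow_nonneg hs.1.le _))]
  exact mul_le_mul_of_nonneg_left (Real.rpow_le_rpow hs.1.le hs.2.le (by linarith)) (by linarith)

variable {V : Type*} [TopologicalSpace V] [Nonempty V]

lemma hasDerivAt_of_hasDerivAt_apply {U F : ℝ → V →ᵇ ℝ} {a b K : ℝ}
    (hd : ∀ x, ∀ s ∈ Ioo a b, HasDerivAt (fun r => U r x) (F s x) s)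
    (hF : ∀ r ∈ Ioo a b, ∀ s ∈ Ioo a b, ‖F r - F s‖ ≤ K * |r - s|) {s : ℝ} (hs : s ∈ Ioo a b) :
    HasDerivAt U (F s) s := by
  rw [hasDerivAt_iff_isLittleO]
  refine Asymptotics.IsBigO.trans_isLittleO ?_
    (Asymptotics.isLittleO_pow_sub_sub s (one_lt_two : 1 < 2))
  refine Asymptotics.IsBigO.of_bound |K| ?_
  filter_upwards [Ioo_mem_nhds hs.1 hs.2] with r hr
  refine norm_le_of_nonempty.2 fun x => ?_
  have hsub : ∀ q ∈ uIcc s r, q ∈ Ioo a b := fun q hq =>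
    (convex_Ioo a b).ordConnected.uIcc_subset hs hr hq
  have h := (convex_uIcc s r).norm_image_sub_le_of_norm_hasDerivWithin_le
    (f := fun q => U q x - q * F s x) (f' := fun q => F q x - 1 * F s x) (C := |K| * |r - s|)
    (fun q hq => ((hd x q (hsub q hq)).sub
      ((hasDerivAt_id q).mul_const (F s x))).hasDerivWithinAt)
    (fun q hq => by
      have h1 := ((F q - F s).norm_coe_le_norm x).trans (hF q (hsub q hq) s hs)
      rw [one_mul]
      refine h1.trans ?_
      exact mul_le_mul (le_abs_self K) (abs_sub_left_of_mem_uIcc hq) (abs_nonneg _)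
        (abs_nonneg _))
    left_mem_uIcc right_mem_uIcc
  calc ‖(U r - U s - (r - s) • F s) x‖ = ‖U r x - r * F s x - (U s x - s * F s x)‖ := by
        congr 1
        simp only [coe_sub, coe_smul, Pi.sub_apply, smul_eq_mul]
        ring
    _ ≤ |K| * |r - s| * ‖r - s‖ := h
    _ = |K| * ‖‖r - s‖ ^ 2‖ := by
        rw [norm_pow, norm_norm, Real.norm_eq_abs]
        ring

variable [DiscreteTopology V] {ω : V → V → ℝ} {μ : V → ℝ}

/-- A solution is a continuously differentiable curve of bounded functions, solving an evolution
equation in the Banach space of bounded functions. -/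
lemma IsHeatSol.exists_curve (hG : IsWeightedGraph ω μ) {C : ℝ}
    (hC : ∀ x, (∑' y, ω x y) ≤ C * μ x) {p : ℝ} (hp : 1 < p) {ψ0 : V → ℝ} {T : ℝ}
    {u : V → ℝ → ℝ} (hu : IsHeatSol (graphLap ω μ) p ψ0 T u) {t : ℝ} (ht : 0 < t) (htT : t < T) :
    ∃ U Q : ℝ → V →ᵇ ℝ, (∀ s ∈ Icc 0 t, ∀ x, U s x = u x s) ∧
      (∀ s ∈ Icc 0 t, ∀ x, Q s x = U s x ^ p) ∧ ContinuousOn U (Icc 0 t) ∧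
      ∀ s ∈ Ioo 0 t, HasDerivAt U (hG.lapCLM hC (U s) + Q s) s := by
  obtain ⟨R, hR⟩ := hu.bounded t ⟨ht, htT⟩
  have hC0 := hG.bound_nonneg hC
  have hR0 : 0 ≤ R := (abs_nonneg _).trans (hR (Classical.arbitrary V) 0 ⟨le_rfl, ht.le⟩)
  have hIco : ∀ s ∈ Icc 0 t, s ∈ Ico 0 T := fun s hs => ⟨hs.1, hs.2.trans_lt htT⟩
  have huR : ∀ x, ∀ s ∈ Icc 0 t, u x s ∈ Icc 0 R := fun x s hs =>
    ⟨hu.nonneg x s (hIco s hs), (le_abs_self _).trans (hR x s hs)⟩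
  have hpow : ∀ x, ∀ s ∈ Icc 0 t, |u x s ^ p| ≤ R ^ p := fun x s hs => by
    rw [abs_of_nonneg (Real.rpow_nonneg (huR x s hs).1 p)]
    exact Real.rpow_le_rpow (huR x s hs).1 (huR x s hs).2 (by linarith)
  let π : ℝ → ℝ := fun s => projIcc 0 t ht.le s
  have hπ : ∀ s, π s ∈ Icc 0 t := fun s => (projIcc 0 t ht.le s).2
  have hπ_eq : ∀ s ∈ Icc 0 t, π s = s := fun s hs => by simp [π, projIcc_of_mem ht.le hs]
  let U : ℝ → V →ᵇ ℝ := fun s =>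
    ofNormedAddCommGroupDiscrete (fun x => u x (π s)) R fun x => hR x _ (hπ s)
  let Q : ℝ → V →ᵇ ℝ := fun s =>
    ofNormedAddCommGroupDiscrete (fun x => u x (π s) ^ p) (R ^ p) fun x => hpow x _ (hπ s)
  have hU : ∀ s ∈ Icc 0 t, ∀ x, U s x = u x s := fun s hs x => by
    simp [U, hπ_eq s hs]
  have hQ : ∀ s ∈ Icc 0 t, ∀ x, Q s x = u x s ^ p := fun s hs x => by
    simp [Q, hπ_eq s hs]
  have hUd : ∀ x, ∀ s ∈ Ioo 0 t,
      HasDerivAt (u x) ((hG.lapCLM hC (U s) + Q s) x) s := fun x s hs => by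
    have h := hu.eqn x s ⟨hs.1, hs.2.trans htT⟩
    have hs' := Ioo_subset_Icc_self hs
    rw [← hQ s hs', ← funext (hU s hs')] at h
    exact h
  set M := 2 * C * R + R ^ p with hM
  have hMbound : ∀ x, ∀ s ∈ Ioo 0 t, |(hG.lapCLM hC (U s) + Q s) x| ≤ M := fun x s hs => by
    have hs' := Ioo_subset_Icc_self hs
    refine (abs_add_le _ _).trans (add_le_add ?_ ?_)
    · exact hG.abs_graphLap_le hC (fun y => by rw [hU s hs']; exact hR y s hs') x
    · rw [hQ s hs']
      exact hpow x s hs'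
  have hlip : ∀ r ∈ Icc 0 t, ∀ s ∈ Icc 0 t, ∀ x, |u x r - u x s| ≤ M * |r - s| :=
    fun r hr s hs x => abs_sub_le_of_abs_deriv_le ((hu.cont x).mono hIco) (hUd x)
      (hMbound x) hr hs
  have hUlip : ∀ r ∈ Icc 0 t, ∀ s ∈ Icc 0 t, ‖U r - U s‖ ≤ M * |r - s| := fun r hr s hs =>
    norm_le_of_nonempty.2 fun x => by
      rw [coe_sub, Pi.sub_apply, hU r hr, hU s hs]
      exact hlip r hr s hs x
  have hM0 : 0 ≤ M := by positivity
  refine ⟨U, Q, hU, fun s hs x => by rw [hQ s hs, hU s hs], ?_, ?_⟩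
  · refine LipschitzOnWith.continuousOn (K := M.toNNReal) (LipschitzOnWith.of_dist_le_mul ?_)
    intro r hr s hs
    rw [dist_eq_norm, Real.dist_eq, Real.coe_toNNReal _ hM0]
    exact hUlip r hr s hs
  · intro s hs
    refine hasDerivAt_of_hasDerivAt_apply (F := fun s => hG.lapCLM hC (U s) + Q s)
      (K := ‖hG.lapCLM hC‖ * M + p * R ^ (p - 1) * M) ?_ ?_ hs
    · intro x r hr
      refine (hUd x r hr).congr_of_eventuallyEq ?_
      filter_upwards [Ioo_mem_nhds hr.1 hr.2] with q hq
      exact hU q (Ioo_subset_Icc_self hq) x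
    · intro r hr s hs
      have hr' := Ioo_subset_Icc_self hr
      have hs' := Ioo_subset_Icc_self hs
      have h1 : ‖hG.lapCLM hC (U r - U s)‖ ≤ ‖hG.lapCLM hC‖ * (M * |r - s|) :=
        (ContinuousLinearMap.le_opNorm _ _).trans (by gcongr; exact hUlip r hr' s hs')
      have h2 : ‖Q r - Q s‖ ≤ p * R ^ (p - 1) * (M * |r - s|) :=
        norm_le_of_nonempty.2 fun x => by
          rw [coe_sub, Pi.sub_apply, hQ r hr', hQ s hs']
          refine (abs_rpow_sub_rpow_le hp (huR x r hr') (huR x s hs')).trans ?_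
          gcongr
          exact hlip r hr' s hs' x
      calc ‖hG.lapCLM hC (U r) + Q r - (hG.lapCLM hC (U s) + Q s)‖
          = ‖hG.lapCLM hC (U r - U s) + (Q r - Q s)‖ := by
            rw [map_sub]
            congr 1
            abel
        _ ≤ (‖hG.lapCLM hC‖ * M + p * R ^ (p - 1) * M) * |r - s| := by
            refine (norm_add_le _ _).trans ((add_le_add h1 h2).trans (le_of_eq ?_))
            ring

end Regularity

/-- Lemma 4.6: if `D_μ < ∞` and `u` solves `u_t = Δu + u^p`, `u(·,0) = λψ` on
`[0, T_λ)`, then for every vertex `x̄` and every `0 < t < T_λ`,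
`(λ ∑_y P(t,x̄,y) ψ(y) μ(y))^{1-p} ≥ (p-1) t`. -/
theorem stmt16 {V : Type*} [Infinite V] [Countable V]
    (ω : V → V → ℝ) (μ : V → ℝ) (hG : IsWeightedGraph ω μ) (hD : DmuFinite ω μ)
    (p : ℝ) (hp : 1 < p) (lam : ℝ) (hlam : 0 < lam)
    (ψ : V → ℝ) (hψ0 : ∀ x, 0 ≤ ψ x) (hψbd : ∃ C : ℝ, ∀ x, ψ x ≤ C)
    (hψne : ∃ x, ψ x ≠ 0)
    (u : V → ℝ → ℝ)
    (hu : ∀ T : ℝ, 0 < T →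
      ENNReal.ofReal T < lifeSpan (graphLap ω μ) p (fun x => lam * ψ x) →
      IsHeatSol (graphLap ω μ) p (fun x => lam * ψ x) T u) :
    ∀ xb : V, ∀ t : ℝ, 0 < t →
      ENNReal.ofReal t < lifeSpan (graphLap ω μ) p (fun x => lam * ψ x) →
      (p - 1) * t ≤ (lam * ∑' y, heatKernel ω μ t xb y * ψ y * μ y) ^ (1 - p) := by
  intro xb t ht htT
  obtain ⟨C, hC⟩ := hD
  obtain ⟨B, hB⟩ := hψbd
  obtain ⟨z, hz⟩ := hψne
  obtain ⟨T', htT', hT'⟩ := exists_between htT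
  have hT'top : T' ≠ ⊤ := hT'.ne_top
  have hT : t < T'.toReal := (ENNReal.ofReal_lt_iff_lt_toReal ht.le hT'top).1 htT'
  have hsol := hu T'.toReal (ht.trans hT) (by rwa [ENNReal.ofReal_toReal hT'top])
  let : TopologicalSpace V := ⊥
  have : DiscreteTopology V := ⟨rfl⟩
  let f : V →ᵇ ℝ := ofNormedAddCommGroupDiscrete ψ B fun x => by
    rw [Real.norm_of_nonneg (hψ0 x)]
    exact hB x
  obtain ⟨U, Q, hU, hQ, hUc, hUd⟩ := hsol.exists_curve hG hC hp ht hT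
  have hU0 : U 0 = lam • f := by
    ext x
    rw [hU 0 ⟨le_rfl, ht.le⟩, hsol.init]
    rfl
  have hUnn : ∀ s ∈ Ioo 0 t, ∀ x, 0 ≤ U s x := fun s hs x => by
    rw [hU s (Ioo_subset_Icc_self hs)]
    exact hsol.nonneg x s ⟨hs.1.le, hs.2.trans hT⟩
  let v : ℝ → ℝ := fun s => opSemigroup (hG.lapCLM hC) (t - s) (U s) xb
  have hv0 : v 0 = lam * ∑' y, heatKernel ω μ t xb y * ψ y * μ y := by
    have h := hG.tsum_heatKernel_mul hC t f xb
    change ∑' y, heatKernel ω μ t xb y * ψ y * μ y = _ at h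
    simp only [v]
    rw [h, sub_zero, hU0, map_smul]
    rfl
  rw [← hv0]
  refine mul_le_rpow_of_rpow_le_deriv hp ht
    (v' := fun s => opSemigroup (hG.lapCLM hC) (t - s) (Q s) xb) ?_ ?_ ?_ ?_ ?_
  · exact (BoundedContinuousFunction.evalCLM ℝ xb).continuous.comp_continuousOn
      (continuousOn_opSemigroup_sub_apply _ t hUc)
  · intro s hs
    exact (BoundedContinuousFunction.evalCLM ℝ xb).hasFDerivAt.comp_hasDerivAt s
      (hasDerivAt_opSemigroup_sub_apply _ t (hUd s hs))
  · intro s hs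
    exact hG.opSemigroup_lapCLM_apply_nonneg hC (sub_nonneg.2 hs.2.le) _ (hUnn s hs) xb
  · intro s hs
    exact rpow_le_of_positive (hG.opSemigroup_lapCLM_apply_nonneg hC (sub_nonneg.2 hs.2.le))
      (opSemigroup_apply_const (hG.lapCLM_const hC) (t - s)) hp (hUnn s hs)
      (hQ s (Ioo_subset_Icc_self hs)) xb
  · simp only [v]
    rw [sub_zero, hU0, map_smul]
    exact mul_pos hlam (hG.opSemigroup_lapCLM_apply_pos hC ht (f := f) hψ0 hz xb)
end
end

section
/- Let G=(V,E,ω,μ) be an infinite, locally finite, connected weighted graph with D_μ<∞, let p>1, and let ψ:V→[0,∞) be bounded with ψ≢0. Suppose ψ(x) ≤ ψ_∞ for all x∈V, where ψ_∞ is a positive constant. Then for every λ>0 the life span satisfies T_λ ≥ 1/((p-1) λ^{p-1} ψ_∞^{p-1}); in particular, liminf_{λ→0} λ^{p-1} T_λ ≥ 1/((p-1) ψ_∞^{p-1}). -/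
open Filter Topology Set
open scoped ENNReal Classical

noncomputable section

/-- The forcing term `∑ y ∈ S x, c x y * u y s + u x s ^ p` of the Duhamel formula. -/
def forcing {V : Type*} (S : V → Finset V) (c : V → V → ℝ) (p : ℝ) (u : V → ℝ → ℝ)
    (x : V) (s : ℝ) : ℝ :=
  (∑ y ∈ S x, c x y * u y s) + u x s ^ p

/-- The Duhamel operator of `u_t = ∑ y ∈ S x, c x y * u y - a x * u x + u x ^ p`. -/
def duhamel {V : Type*} (S : V → Finset V) (c : V → V → ℝ) (a : V → ℝ) (p : ℝ) (ψ : V → ℝ)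
    (u : V → ℝ → ℝ) (x : V) (t : ℝ) : ℝ :=
  Real.exp (-(a x * t)) *
    (ψ x + ∫ s in (0 : ℝ)..t, Real.exp (a x * s) * forcing S c p u x s)

/-- The monotone Duhamel iteration started at zero. -/
def duhamelIter {V : Type*} (S : V → Finset V) (c : V → V → ℝ) (a : V → ℝ) (p : ℝ)
    (ψ : V → ℝ) : ℕ → V → ℝ → ℝ
  | 0 => fun _ _ => 0
  | n + 1 => duhamel S c a p ψ (duhamelIter S c a p ψ n)

section Duhamel

variable {V : Type*} {S : V → Finset V} {c : V → V → ℝ} {a : V → ℝ} {p : ℝ} {ψ : V → ℝ}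

lemma forcing_nonneg (hc : ∀ x y, 0 ≤ c x y) {u : V → ℝ → ℝ} {s : ℝ}
    (hu : ∀ x, 0 ≤ u x s) (x : V) : 0 ≤ forcing S c p u x s :=
  add_nonneg (Finset.sum_nonneg fun y _ => mul_nonneg (hc x y) (hu y))
    (Real.rpow_nonneg (hu x) p)

lemma forcing_mono (hc : ∀ x y, 0 ≤ c x y) (hp : 0 ≤ p) {u v : V → ℝ → ℝ} {s : ℝ}
    (hu : ∀ x, 0 ≤ u x s) (huv : ∀ x, u x s ≤ v x s) (x : V) :
    forcing S c p u x s ≤ forcing S c p v x s :=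
  add_le_add (Finset.sum_le_sum fun y _ => mul_le_mul_of_nonneg_left (huv y) (hc x y))
    (Real.rpow_le_rpow (hu x) (huv x) hp)

lemma continuousOn_forcing (hp : 0 ≤ p) {u : V → ℝ → ℝ} {I : Set ℝ}
    (hu : ∀ x, ContinuousOn (u x) I) (x : V) : ContinuousOn (forcing S c p u x) I :=
  (continuousOn_finsetSum _ fun y _ => continuousOn_const.mul (hu y)).add
    ((hu x).rpow_const fun _ _ => Or.inr hp)

lemma continuousOn_exp_mul_forcing (hp : 0 ≤ p) {u : V → ℝ → ℝ} {I : Set ℝ}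
    (hu : ∀ x, ContinuousOn (u x) I) (x : V) :
    ContinuousOn (fun s => Real.exp (a x * s) * forcing S c p u x s) I :=
  (Continuous.continuousOn (by fun_prop)).mul (continuousOn_forcing hp hu x)

lemma continuous_duhamelIter (hp : 0 ≤ p) (n : ℕ) (x : V) :
    Continuous (duhamelIter S c a p ψ n x) := by
  induction n generalizing x with
  | zero => exact continuous_const
  | succ n ih =>
    have hf : Continuous fun s =>
        Real.exp (a x * s) * forcing S c p (duhamelIter S c a p ψ n) x s :=
      continuousOn_univ.1 (continuousOn_exp_mul_forcing hp (fun y => (ih y).continuousOn) x)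
    have hi := intervalIntegral.continuous_primitive (μ := MeasureTheory.volume)
      (fun r s => hf.intervalIntegrable r s) 0
    exact Continuous.mul (by fun_prop) (continuous_const.add hi)

lemma intervalIntegrable_duhamelIter (hp : 0 ≤ p) (n : ℕ) (x : V) (r t : ℝ) :
    IntervalIntegrable (fun s =>
      Real.exp (a x * s) * forcing S c p (duhamelIter S c a p ψ n) x s)
      MeasureTheory.volume r t :=
  (continuousOn_exp_mul_forcing hp
    (fun y => (continuous_duhamelIter hp n y).continuousOn) x).intervalIntegrable

lemma duhamel_nonneg (hc : ∀ x y, 0 ≤ c x y) (hψ : ∀ x, 0 ≤ ψ x) {u : V → ℝ → ℝ}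
    {t : ℝ} (ht : 0 ≤ t) (hu : ∀ x, ∀ s ∈ Icc 0 t, 0 ≤ u x s) (x : V) :
    0 ≤ duhamel S c a p ψ u x t :=
  mul_nonneg (Real.exp_pos _).le (add_nonneg (hψ x)
    (intervalIntegral.integral_nonneg ht fun s hs =>
      mul_nonneg (Real.exp_pos _).le (forcing_nonneg hc (fun y => hu y s hs) x)))

lemma duhamelIter_nonneg (hc : ∀ x y, 0 ≤ c x y) (hψ : ∀ x, 0 ≤ ψ x) (n : ℕ) (x : V)
    {t : ℝ} (ht : 0 ≤ t) : 0 ≤ duhamelIter S c a p ψ n x t := by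
  induction n generalizing x t with
  | zero => exact le_rfl
  | succ n ih => exact duhamel_nonneg hc hψ ht (fun y s hs => ih y hs.1) x

lemma duhamelIter_le_succ (hc : ∀ x y, 0 ≤ c x y) (hψ : ∀ x, 0 ≤ ψ x) (hp : 0 ≤ p) (n : ℕ)
    (x : V) {t : ℝ} (ht : 0 ≤ t) :
    duhamelIter S c a p ψ n x t ≤ duhamelIter S c a p ψ (n + 1) x t := by
  induction n generalizing x t with
  | zero => exact duhamelIter_nonneg hc hψ 1 x ht
  | succ n ih =>
    refine mul_le_mul_of_nonneg_left (add_le_add le_rfl ?_) (Real.exp_pos _).le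
    refine intervalIntegral.integral_mono_on ht (intervalIntegrable_duhamelIter hp n x 0 t)
      (intervalIntegrable_duhamelIter hp (n + 1) x 0 t) fun s hs => ?_
    exact mul_le_mul_of_nonneg_left (forcing_mono hc hp
      (fun y => duhamelIter_nonneg hc hψ n y hs.1) (fun y => ih y hs.1) x) (Real.exp_pos _).le

variable {z : ℝ → ℝ} {T : ℝ}

lemma continuousOn_of_blowup_ode (hz : ∀ t ∈ Ico 0 T, HasDerivAt z (z t ^ p) t) :
    ContinuousOn z (Ico 0 T) :=
  fun t ht => (hz t ht).continuousAt.continuousWithinAt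

lemma intervalIntegrable_forcing_ode (hp : 0 ≤ p)
    (hz : ∀ t ∈ Ico 0 T, HasDerivAt z (z t ^ p) t) (x : V) {t : ℝ} (ht : t ∈ Ico 0 T) :
    IntervalIntegrable (fun s => Real.exp (a x * s) * forcing S c p (fun _ => z) x s)
      MeasureTheory.volume 0 t := by
  refine ContinuousOn.intervalIntegrable ?_
  rw [uIcc_of_le ht.1]
  exact (continuousOn_exp_mul_forcing hp (fun _ => continuousOn_of_blowup_ode hz) x).mono
    (Icc_subset_Ico_right ht.2)

/-- A spatially constant solution is a fixed point of the Duhamel operator. -/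
lemma integral_forcing_ode (ha : ∀ x, ∑ y ∈ S x, c x y = a x) (hp : 0 ≤ p)
    (hz : ∀ t ∈ Ico 0 T, HasDerivAt z (z t ^ p) t) (x : V) {t : ℝ} (ht : t ∈ Ico 0 T) :
    ∫ s in (0 : ℝ)..t, Real.exp (a x * s) * forcing S c p (fun _ => z) x s =
      Real.exp (a x * t) * z t - z 0 := by
  have h := intervalIntegral.integral_eq_sub_of_hasDerivAt (a := 0) (b := t)
    (f := fun s => Real.exp (a x * s) * z s)
    (f' := fun s => Real.exp (a x * s) * forcing S c p (fun _ => z) x s) ?_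
    (intervalIntegrable_forcing_ode hp hz x ht)
  · simpa using h
  · intro s hs
    rw [uIcc_of_le ht.1] at hs
    have h1 : HasDerivAt (fun s => Real.exp (a x * s)) (Real.exp (a x * s) * (a x * 1)) s :=
      ((hasDerivAt_id s).const_mul (a x)).exp
    refine (h1.mul (hz s ⟨hs.1, hs.2.trans_lt ht.2⟩)).congr_deriv ?_
    simp only [forcing, ← Finset.sum_mul, ha x]
    ring

lemma duhamelIter_le (hc : ∀ x y, 0 ≤ c x y) (ha : ∀ x, ∑ y ∈ S x, c x y = a x)
    (hψ : ∀ x, 0 ≤ ψ x) (hp : 0 ≤ p) (hz : ∀ t ∈ Ico 0 T, HasDerivAt z (z t ^ p) t)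
    (hz0 : ∀ t ∈ Ico 0 T, 0 ≤ z t) (hψz : ∀ x, ψ x ≤ z 0) (n : ℕ) (x : V) {t : ℝ}
    (ht : t ∈ Ico 0 T) : duhamelIter S c a p ψ n x t ≤ z t := by
  induction n generalizing x t with
  | zero => exact hz0 t ht
  | succ n ih =>
    have h : ∫ s in (0 : ℝ)..t,
        Real.exp (a x * s) * forcing S c p (duhamelIter S c a p ψ n) x s ≤
        ∫ s in (0 : ℝ)..t, Real.exp (a x * s) * forcing S c p (fun _ => z) x s := by
      refine intervalIntegral.integral_mono_on ht.1 (intervalIntegrable_duhamelIter hp n x 0 t)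
        (intervalIntegrable_forcing_ode hp hz x ht) fun s hs => ?_
      exact mul_le_mul_of_nonneg_left (forcing_mono hc hp
        (fun y => duhamelIter_nonneg hc hψ n y hs.1)
        (fun y => ih y ⟨hs.1, hs.2.trans_lt ht.2⟩) x) (Real.exp_pos _).le
    rw [integral_forcing_ode ha hp hz x ht] at h
    calc duhamelIter S c a p ψ (n + 1) x t
        ≤ Real.exp (-(a x * t)) * (z 0 + (Real.exp (a x * t) * z t - z 0)) :=
          mul_le_mul_of_nonneg_left (add_le_add (hψz x) h) (Real.exp_pos _).le
      _ = z t := by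
          rw [add_sub_cancel, ← mul_assoc, ← Real.exp_add, neg_add_cancel, Real.exp_zero, one_mul]

/-- Below a spatially constant solution, the Duhamel operator has a measurable fixed point. -/
lemma exists_duhamel_fixedPoint (hc : ∀ x y, 0 ≤ c x y) (ha : ∀ x, ∑ y ∈ S x, c x y = a x)
    (hψ : ∀ x, 0 ≤ ψ x) (hp : 0 ≤ p) (hz : ∀ t ∈ Ico 0 T, HasDerivAt z (z t ^ p) t)
    (hz0 : ∀ t ∈ Ico 0 T, 0 ≤ z t) (hψz : ∀ x, ψ x ≤ z 0) :
    ∃ u : V → ℝ → ℝ, (∀ x, Measurable (u x)) ∧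
      (∀ x, ∀ t ∈ Ico 0 T, 0 ≤ u x t ∧ u x t ≤ z t) ∧
      ∀ x, ∀ t ∈ Ico 0 T, u x t = duhamel S c a p ψ u x t := by
  set w := duhamelIter S c a p ψ
  have hlim : ∀ x, ∀ t ∈ Ico 0 T, Tendsto (fun n => w n x t) atTop (𝓝 (⨆ n, w n x t)) :=
    fun x t ht => tendsto_atTop_ciSup
      (monotone_nat_of_le_succ fun n => duhamelIter_le_succ hc hψ hp n x ht.1)
      ⟨z t, by rintro _ ⟨n, rfl⟩; exact duhamelIter_le hc ha hψ hp hz hz0 hψz n x ht⟩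
  refine ⟨fun x t => ⨆ n, w n x t,
    fun x => Measurable.iSup fun n => (continuous_duhamelIter hp n x).measurable,
    fun x t ht => ⟨ge_of_tendsto' (hlim x t ht) fun n => duhamelIter_nonneg hc hψ n x ht.1,
      le_of_tendsto' (hlim x t ht) fun n => duhamelIter_le hc ha hψ hp hz hz0 hψz n x ht⟩,
    fun x t ht => tendsto_nhds_unique ((hlim x t ht).comp (tendsto_add_atTop_nat 1)) ?_⟩
  refine Tendsto.const_mul _ (Tendsto.const_add _ ?_)
  refine intervalIntegral.tendsto_integral_filter_of_dominated_convergence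
    (fun s => Real.exp (a x * s) * forcing S c p (fun _ => z) x s)
    (Eventually.of_forall fun n =>
      (intervalIntegrable_iff.1 (intervalIntegrable_duhamelIter hp n x 0 t)).aestronglyMeasurable)
    (Eventually.of_forall fun n => Eventually.of_forall fun s hs => ?_)
    (intervalIntegrable_forcing_ode hp hz x ht) (Eventually.of_forall fun s hs => ?_)
  all_goals
    rw [uIoc_of_le ht.1] at hs
    have hs' : s ∈ Ico 0 T := ⟨hs.1.le, hs.2.trans_lt ht.2⟩
  · rw [Real.norm_of_nonneg (mul_nonneg (Real.exp_pos _).le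
      (forcing_nonneg hc (fun y => duhamelIter_nonneg hc hψ n y hs'.1) x))]
    exact mul_le_mul_of_nonneg_left (forcing_mono hc hp
      (fun y => duhamelIter_nonneg hc hψ n y hs'.1)
      (fun y => duhamelIter_le hc ha hψ hp hz hz0 hψz n y hs') x) (Real.exp_pos _).le
  · refine Tendsto.const_mul _ (Tendsto.add ?_ ?_)
    · exact tendsto_finsetSum _ fun y _ => (hlim y s hs').const_mul _
    · exact (hlim x s hs').rpow_const (Or.inr hp)

lemma intervalIntegrable_forcing_of_le (hc : ∀ x y, 0 ≤ c x y) (hp : 0 ≤ p)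
    (hz : ∀ t ∈ Ico 0 T, HasDerivAt z (z t ^ p) t) {u : V → ℝ → ℝ}
    (hum : ∀ x, Measurable (u x)) (hu : ∀ x, ∀ t ∈ Ico 0 T, 0 ≤ u x t ∧ u x t ≤ z t)
    (x : V) {t : ℝ} (ht : t ∈ Ico 0 T) :
    IntervalIntegrable (fun s => Real.exp (a x * s) * forcing S c p u x s)
      MeasureTheory.volume 0 t := by
  have hm : Measurable fun s => Real.exp (a x * s) * forcing S c p u x s := by
    have := hum
    unfold forcing
    fun_prop
  refine (intervalIntegrable_forcing_ode (S := S) (c := c) (a := a) hp hz x ht).mono_fun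
    hm.aestronglyMeasurable ?_
  refine (MeasureTheory.ae_restrict_iff' measurableSet_uIoc).2 (Eventually.of_forall ?_)
  intro s hs
  rw [uIoc_of_le ht.1] at hs
  have hs' : s ∈ Ico 0 T := ⟨hs.1.le, hs.2.trans_lt ht.2⟩
  have h0 := fun y => (hu y s hs').1
  have hle := mul_le_mul_of_nonneg_left (forcing_mono (S := S) (v := fun _ => z) hc hp h0
    (fun y => (hu y s hs').2) x) (Real.exp_pos (a x * s)).le
  have hpos := mul_nonneg (Real.exp_pos (a x * s)).le (forcing_nonneg (S := S) (p := p) hc h0 x)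
  beta_reduce
  rwa [Real.norm_of_nonneg hpos, Real.norm_of_nonneg (hpos.trans hle)]

/-- A spatially constant solution of the reaction equation which dominates the initial datum
forces the existence of a solution below it. -/
lemma exists_isHeatSol_of_ode {L : (V → ℝ) → V → ℝ} (hc : ∀ x y, 0 ≤ c x y)
    (ha : ∀ x, ∑ y ∈ S x, c x y = a x)
    (hL : ∀ u x, L u x = (∑ y ∈ S x, c x y * u y) - a x * u x)
    (hψ : ∀ x, 0 ≤ ψ x) (hp : 0 ≤ p) (hT : 0 < T)
    (hz : ∀ t ∈ Ico 0 T, HasDerivAt z (z t ^ p) t)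
    (hz0 : ∀ t ∈ Ico 0 T, 0 ≤ z t) (hψz : ∀ x, ψ x ≤ z 0) :
    ∃ u, IsHeatSol L p ψ T u := by
  obtain ⟨u, hum, hu, hfix⟩ := exists_duhamel_fixedPoint hc ha hψ hp hz hz0 hψz
  have hint := fun x t ht => intervalIntegrable_forcing_of_le (S := S) (a := a) (t := t)
    hc hp hz hum hu x ht
  have hcont : ∀ x, ContinuousOn (u x) (Ico 0 T) := by
    intro x
    refine ContinuousOn.congr (f := duhamel S c a p ψ u x) (fun t ht => ?_) (hfix x)
    obtain ⟨r, htr, hrT⟩ := exists_between ht.2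
    have hr : (0 : ℝ) ≤ r := ht.1.trans htr.le
    have hi : ContinuousOn (fun t => ∫ s in (0 : ℝ)..t,
        Real.exp (a x * s) * forcing S c p u x s) (Icc 0 r) := by
      have h := intervalIntegral.continuousOn_primitive_interval' (hint x r ⟨hr, hrT⟩)
        left_mem_uIcc
      rwa [uIcc_of_le hr] at h
    have hd : ContinuousOn (duhamel S c a p ψ u x) (Icc 0 r) :=
      ContinuousOn.mul (Continuous.continuousOn (by fun_prop)) (continuousOn_const.add hi)
    refine (hd t ⟨ht.1, htr.le⟩).mono_of_mem_nhdsWithin ?_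
    filter_upwards [self_mem_nhdsWithin, mem_nhdsWithin_of_mem_nhds (Iio_mem_nhds htr)]
      with s hs hsr using ⟨hs.1, le_of_lt hsr⟩
  refine ⟨u, fun x t ht => (hu x t ht).1, hcont, ?_, ?_, ?_⟩
  · rintro T' ⟨-, hT'⟩
    obtain ⟨C, hC⟩ := (isCompact_Icc.bddAbove_image
      ((continuousOn_of_blowup_ode hz).mono (Icc_subset_Ico_right hT')))
    refine ⟨C, fun x t ht => ?_⟩
    have ht' := hu x t ⟨ht.1, ht.2.trans_lt hT'⟩
    rw [abs_of_nonneg ht'.1]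
    exact ht'.2.trans (hC ⟨t, ht, rfl⟩)
  · intro x t ht
    have hg := (continuousOn_exp_mul_forcing (S := S) (c := c) (a := a) hp hcont x).mono
      Ioo_subset_Ico_self
    have hI := intervalIntegral.integral_hasDerivAt_right (hint x t ⟨ht.1.le, ht.2⟩)
      (hg.stronglyMeasurableAtFilter isOpen_Ioo t ht)
      (hg.continuousAt (Ioo_mem_nhds ht.1 ht.2))
    have hE : HasDerivAt (fun s => Real.exp (-(a x * s)))
        (Real.exp (-(a x * t)) * -(a x * 1)) t :=
      ((hasDerivAt_id t).const_mul (a x)).neg.exp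
    have hd := (hE.mul (hI.const_add (ψ x))).congr_of_eventuallyEq (f₁ := u x) (by
      filter_upwards [Ioo_mem_nhds ht.1 ht.2] with s hs
      exact hfix x s ⟨hs.1.le, hs.2⟩)
    refine hd.congr_deriv ?_
    have h1 : Real.exp (-(a x * t)) * Real.exp (a x * t) = 1 := by
      rw [← Real.exp_add, neg_add_cancel, Real.exp_zero]
    have h2 := hfix x t ⟨ht.1.le, ht.2⟩
    rw [hL]
    rw [duhamel] at h2
    symm
    rw [← mul_assoc (Real.exp (-(a x * t))) (Real.exp (a x * t)), h1, one_mul, forcing,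
      mul_right_comm, ← h2]
    ring
  · intro x
    simpa [duhamel] using hfix x 0 ⟨le_rfl, hT⟩

end Duhamel

/-- The explicit solution of `z' = z ^ p` with `z 0 = M`. -/
lemma exists_blowup_ode {p M : ℝ} (hp : 1 < p) (hM : 0 < M) :
    ∃ z : ℝ → ℝ, z 0 = M ∧ ∀ t ∈ Ico 0 (1 / ((p - 1) * M ^ (p - 1))),
      HasDerivAt z (z t ^ p) t ∧ 0 ≤ z t := by
  have hp1 : 0 < p - 1 := sub_pos.2 hp
  have hMp : 0 < M ^ (p - 1) := Real.rpow_pos_of_pos hM _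
  refine ⟨fun t => ((M ^ (p - 1))⁻¹ - (p - 1) * t) ^ (-(p - 1)⁻¹), ?_, fun t ht => ?_⟩
  · change ((M ^ (p - 1))⁻¹ - (p - 1) * 0) ^ (-(p - 1)⁻¹) = M
    rw [mul_zero, sub_zero, Real.inv_rpow hMp.le, ← Real.rpow_neg hMp.le, neg_neg,
      Real.rpow_rpow_inv hM.le hp1.ne']
  · have hb : 0 < (M ^ (p - 1))⁻¹ - (p - 1) * t := by
      have h := (lt_div_iff₀ (by positivity)).1 ht.2
      rw [sub_pos, ← one_div, lt_div_iff₀ hMp]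
      linarith
    refine ⟨?_, (Real.rpow_pos_of_pos hb _).le⟩
    have hd : HasDerivAt (fun t : ℝ => (M ^ (p - 1))⁻¹ - (p - 1) * t) (-((p - 1) * 1)) t :=
      ((hasDerivAt_id t).const_mul (p - 1)).const_sub _
    refine (hd.rpow_const (p := -(p - 1)⁻¹) (Or.inl hb.ne')).congr_deriv ?_
    have he : -(p - 1)⁻¹ * p = -(p - 1)⁻¹ - 1 := by
      field_simp
      ring
    rw [← Real.rpow_mul hb.le, he]
    field_simp

lemma graphLap_eq_sum {V : Type*} {ω : V → V → ℝ} {μ : V → ℝ} (hG : IsWeightedGraph ω μ)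
    (u : V → ℝ) (x : V) :
    graphLap ω μ u x = (∑ y ∈ (hG.locallyFinite x).toFinset, ω x y / μ x * u y) -
      (∑ y ∈ (hG.locallyFinite x).toFinset, ω x y / μ x) * u x := by
  have h0 : ∀ y ∉ (hG.locallyFinite x).toFinset, ω x y * (u y - u x) = 0 := by
    intro y hy
    have hy' : ¬ 0 < ω x y := by simpa using hy
    rw [le_antisymm (not_lt.1 hy') (hG.nonneg x y), zero_mul]
  rw [graphLap, tsum_eq_sum h0, Finset.mul_sum, Finset.sum_mul, ← Finset.sum_sub_distrib]
  exact Finset.sum_congr rfl fun y _ => by ring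

lemma le_lifeSpan_graphLap {V : Type*} {ω : V → V → ℝ} {μ : V → ℝ}
    (hG : IsWeightedGraph ω μ) {p M : ℝ} (hp : 1 < p) (hM : 0 < M) {ψ : V → ℝ}
    (hψ : ∀ x, 0 ≤ ψ x) (hψM : ∀ x, ψ x ≤ M) :
    ENNReal.ofReal (1 / ((p - 1) * M ^ (p - 1))) ≤ lifeSpan (graphLap ω μ) p ψ := by
  obtain ⟨z, hz0, hz⟩ := exists_blowup_ode hp hM
  have hT : 0 < 1 / ((p - 1) * M ^ (p - 1)) :=
    one_div_pos.2 (mul_pos (sub_pos.2 hp) (Real.rpow_pos_of_pos hM _))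
  refine le_iSup₂_of_le (1 / ((p - 1) * M ^ (p - 1))) ⟨hT, ?_⟩ le_rfl
  exact exists_isHeatSol_of_ode (c := fun x y => ω x y / μ x)
    (fun x y => div_nonneg (hG.nonneg x y) (hG.measurePos x).le) (fun _ => rfl)
    (graphLap_eq_sum hG) hψ (by linarith) hT (fun t ht => (hz t ht).1)
    (fun t ht => (hz t ht).2) (fun x => hz0 ▸ hψM x)

/-- Lemma 4.8: if `D_μ < ∞` and `ψ ≤ ψ_∞` on `V` with `ψ_∞ > 0`, then
`T_λ ≥ 1/((p-1) λ^{p-1} ψ_∞^{p-1})` for every `λ > 0`; in particular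
`liminf_{λ→0} λ^{p-1} T_λ ≥ 1/((p-1) ψ_∞^{p-1})`. -/
theorem stmt18 {V : Type*} [Infinite V] [Countable V]
    (ω : V → V → ℝ) (μ : V → ℝ) (hG : IsWeightedGraph ω μ) (hD : DmuFinite ω μ)
    (p : ℝ) (hp : 1 < p)
    (ψ : V → ℝ) (hψ0 : ∀ x, 0 ≤ ψ x) (hψne : ∃ x, ψ x ≠ 0)
    (psiInf : ℝ) (hpsiInf : 0 < psiInf) (hub : ∀ x, ψ x ≤ psiInf) :
    (∀ lam : ℝ, 0 < lam →
      ENNReal.ofReal (1 / ((p - 1) * lam ^ (p - 1) * psiInf ^ (p - 1))) ≤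
        lifeSpan (graphLap ω μ) p (fun x => lam * ψ x)) ∧
    ENNReal.ofReal (1 / ((p - 1) * psiInf ^ (p - 1))) ≤
      liminf (fun lam : ℝ => ENNReal.ofReal (lam ^ (p - 1)) *
        lifeSpan (graphLap ω μ) p (fun x => lam * ψ x)) (𝓝[>] (0:ℝ)) := by
  have key : ∀ lam : ℝ, 0 < lam →
      ENNReal.ofReal (1 / ((p - 1) * lam ^ (p - 1) * psiInf ^ (p - 1))) ≤
        lifeSpan (graphLap ω μ) p (fun x => lam * ψ x) := by
    intro lam hlam
    rw [mul_assoc, ← Real.mul_rpow hlam.le hpsiInf.le]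
    exact le_lifeSpan_graphLap hG hp (mul_pos hlam hpsiInf)
      (fun x => mul_nonneg hlam.le (hψ0 x)) fun x => mul_le_mul_of_nonneg_left (hub x) hlam.le
  refine ⟨key, le_liminf_of_le (by isBoundedDefault) ?_⟩
  filter_upwards [self_mem_nhdsWithin] with lam hlam
  have hl : 0 < lam ^ (p - 1) := Real.rpow_pos_of_pos hlam _
  calc ENNReal.ofReal (1 / ((p - 1) * psiInf ^ (p - 1)))
      = ENNReal.ofReal (lam ^ (p - 1)) *
          ENNReal.ofReal (1 / ((p - 1) * lam ^ (p - 1) * psiInf ^ (p - 1))) := by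
        rw [← ENNReal.ofReal_mul hl.le]
        congr 1
        field_simp
    _ ≤ _ := by gcongr; exact key lam hlam
end
end
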